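/- Over an algebraically closed field F of characteristic p ≥ 3, there are only finitely many isomorphism classes of irreducible sl_2(F)-modules with character χ = 0 (the restricted irreducible modules), and their number is exactly p. -/

import Mathlib

/-- A bundled irreducible restricted representation (character `χ = 0`) of the Lie algebra
spanned by an `sl₂`-triple `e, h, f`: the central elements `x^p - x^[p]` act as zero, which on
the basis means `ρ(e)^p = 0`, `ρ(h)^p = ρ(h)`, `ρ(f)^p = 0`. -/
structure RestrictedIrredRep (F : Type) [Field F] (p : ℕ)
    (L : Type) [LieRing L] [LieAlgebra F L] (e h f : L) where
  V : Type
  [addCommGroup : AddCommGroup V]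
  [module : Module F V]
  [lieRingModule : LieRingModule L V]
  [lieModule : LieModule F L V]
  irreducible : LieModule.IsIrreducible F L V
  res_e : (LieModule.toEnd F L V e) ^ p = 0
  res_h : (LieModule.toEnd F L V h) ^ p = LieModule.toEnd F L V h
  res_f : (LieModule.toEnd F L V f) ^ p = 0

attribute [instance] RestrictedIrredRep.addCommGroup RestrictedIrredRep.module
  RestrictedIrredRep.lieRingModule RestrictedIrredRep.lieModule

namespace Sl2R

attribute [local instance] LieRing.ofAssociativeRing

/-- Extension by zero of a finite sequence. -/
def ext {F : Type} [Field F] {n : ℕ} (x : Fin (n + 1) → F) (i : ℕ) : F :=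
  if hi : i < n + 1 then x ⟨i, hi⟩ else 0

lemma ext_lt {F : Type} [Field F] {n : ℕ} (x : Fin (n + 1) → F) {i : ℕ} (hi : i < n + 1) :
    ext x i = x ⟨i, hi⟩ := by simp [ext, hi]

lemma ext_ge {F : Type} [Field F] {n : ℕ} (x : Fin (n + 1) → F) {i : ℕ} (hi : n + 1 ≤ i) :
    ext x i = 0 := by simp [ext, not_lt.mpr hi]

lemma ext_fin {F : Type} [Field F] {n : ℕ} (x : Fin (n + 1) → F) (i : Fin (n + 1)) :
    ext x i = x i := ext_lt x i.2

lemma ext_add {F : Type} [Field F] {n : ℕ} (x y : Fin (n + 1) → F) (i : ℕ) :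
    ext (x + y) i = ext x i + ext y i := by
  unfold ext; split_ifs <;> simp

lemma ext_smul {F : Type} [Field F] {n : ℕ} (c : F) (x : Fin (n + 1) → F) (i : ℕ) :
    ext (c • x) i = c * ext x i := by
  unfold ext; split_ifs <;> simp

/-- The raising operator. -/
def opE (F : Type) [Field F] (n : ℕ) : Module.End F (Fin (n + 1) → F) where
  toFun x i := ((i : ℕ) + 1 : F) * ((n : F) - (i : ℕ)) * ext x (i + 1)
  map_add' x y := by funext i; simp [ext_add]; ring
  map_smul' c x := by funext i; simp [ext_smul]; ring

/-- The Cartan operator. -/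
def opH (F : Type) [Field F] (n : ℕ) : Module.End F (Fin (n + 1) → F) where
  toFun x i := ((n : F) - 2 * (i : ℕ)) * x i
  map_add' x y := by funext i; simp; ring
  map_smul' c x := by funext i; simp; ring

/-- The lowering operator. -/
def opF (F : Type) [Field F] (n : ℕ) : Module.End F (Fin (n + 1) → F) where
  toFun x i := if (i : ℕ) = 0 then 0 else ext x (i - 1)
  map_add' x y := by funext i; simp [ext_add]; split_ifs <;> simp
  map_smul' c x := by funext i; simp [ext_smul]

section
variable {F : Type} [Field F] {n : ℕ}

lemma ext_opE (x : Fin (n + 1) → F) (i : ℕ) :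
    ext (opE F n x) i = ((i : ℕ) + 1 : F) * ((n : F) - (i : ℕ)) * ext x (i + 1) := by
  by_cases hi : i < n + 1
  · rw [ext_lt _ hi]; rfl
  · rw [ext_ge _ (by omega), ext_ge _ (by omega)]; simp

lemma ext_opH (x : Fin (n + 1) → F) (i : ℕ) :
    ext (opH F n x) i = ((n : F) - 2 * (i : ℕ)) * ext x i := by
  by_cases hi : i < n + 1
  · rw [ext_lt _ hi, ext_lt _ hi]; rfl
  · rw [ext_ge _ (by omega), ext_ge _ (by omega)]; simp

lemma ext_opF_zero (x : Fin (n + 1) → F) : ext (opF F n x) 0 = 0 := by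
  rw [ext_lt _ (by omega)]; simp [opF]

lemma ext_opF_succ (x : Fin (n + 1) → F) (i : ℕ) (hi : i + 1 < n + 1) :
    ext (opF F n x) (i + 1) = ext x i := by
  rw [ext_lt _ hi]; simp [opF]

lemma ext_inj {x y : Fin (n + 1) → F} (h : ∀ i, i < n + 1 → ext x i = ext y i) : x = y := by
  funext i
  rw [← ext_fin x, ← ext_fin y]
  exact h i i.2

lemma ext_sub (x y : Fin (n + 1) → F) (i : ℕ) :
    ext (x - y) i = ext x i - ext y i := by
  unfold ext; split_ifs <;> simp

lemma rel_he : ⁅opH F n, opE F n⁆ = (2 : F) • opE F n := by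
  refine LinearMap.ext fun x => ext_inj fun i _ => ?_
  rw [Ring.lie_def, LinearMap.sub_apply, LinearMap.smul_apply, Module.End.mul_apply,
    Module.End.mul_apply, ext_sub, ext_smul, ext_opH, ext_opE, ext_opE, ext_opH]
  push_cast; ring

lemma rel_hf : ⁅opH F n, opF F n⁆ = (-2 : F) • opF F n := by
  refine LinearMap.ext fun x => ext_inj fun i hi => ?_
  rw [Ring.lie_def, LinearMap.sub_apply, LinearMap.smul_apply, Module.End.mul_apply,
    Module.End.mul_apply, ext_sub, ext_smul, ext_opH]
  cases i with
  | zero => simp [ext_opF_zero]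
  | succ i =>
    rw [ext_opF_succ _ _ hi, ext_opF_succ _ _ hi, ext_opH]
    push_cast; ring

lemma rel_ef : ⁅opE F n, opF F n⁆ = opH F n := by
  refine LinearMap.ext fun x => ext_inj fun i hi => ?_
  rw [Ring.lie_def, LinearMap.sub_apply, Module.End.mul_apply,
    Module.End.mul_apply, ext_sub, ext_opH, ext_opE]
  have h1 : ((i : ℕ) + 1 : F) * ((n : F) - (i : ℕ)) * ext (opF F n x) (i + 1) =
      ((i : ℕ) + 1 : F) * ((n : F) - (i : ℕ)) * ext x i := by
    by_cases h : i + 1 < n + 1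
    · rw [ext_opF_succ _ _ h]
    · obtain rfl : i = n := by omega
      simp
  rw [h1]
  cases i with
  | zero => simp [ext_opF_zero]
  | succ i =>
    rw [ext_opF_succ _ _ hi, ext_opE]
    push_cast; ring

lemma opE_pow (k : ℕ) (x : Fin (n + 1) → F) (i : ℕ) (h : n < i + k) :
    ext ((opE F n ^ k) x) i = 0 := by
  induction k generalizing i with
  | zero => rw [ext_ge _ (by omega)]
  | succ k ih =>
    rw [pow_succ', Module.End.mul_apply, ext_opE, ih _ (by omega), mul_zero]

lemma opF_pow (k : ℕ) (x : Fin (n + 1) → F) (i : ℕ) (h : i < k) :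
    ext ((opF F n ^ k) x) i = 0 := by
  induction k generalizing i with
  | zero => omega
  | succ k ih =>
    rw [pow_succ', Module.End.mul_apply]
    cases i with
    | zero => rw [ext_opF_zero]
    | succ i =>
      by_cases hi : i + 1 < n + 1
      · rw [ext_opF_succ _ _ hi, ih _ (by omega)]
      · rw [ext_ge _ (by omega)]

lemma opH_pow (k : ℕ) (x : Fin (n + 1) → F) (i : ℕ) :
    ext ((opH F n ^ k) x) i = ((n : F) - 2 * (i : ℕ)) ^ k * ext x i := by
  induction k generalizing i with
  | zero => simp
  | succ k ih =>
    rw [pow_succ', Module.End.mul_apply, ext_opH, ih]; ring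

lemma ext_zero (i : ℕ) : ext (0 : Fin (n + 1) → F) i = 0 := by
  unfold ext; split_ifs <;> rfl

lemma opE_pow_p {p : ℕ} (h : n < p) : opE F n ^ p = 0 :=
  LinearMap.ext fun x => ext_inj fun i _ => by
    rw [opE_pow _ _ _ (by omega)]; simp [ext_zero]

lemma opF_pow_p {p : ℕ} (h : n < p) : opF F n ^ p = 0 :=
  LinearMap.ext fun x => ext_inj fun i _ => by
    rw [opF_pow _ _ _ (by omega)]; simp [ext_zero]

lemma opH_pow_p {p : ℕ} [Fact p.Prime] [CharP F p] : opH F n ^ p = opH F n :=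
  LinearMap.ext fun x => ext_inj fun i _ => by
    rw [opH_pow, ext_opH]
    congr 1
    have := map_intCast (frobenius F p) ((n : ℤ) - 2 * i)
    rw [frobenius_def] at this
    push_cast at this
    exact this

/-- The highest weight vector. -/
def v0 (F : Type) [Field F] (n : ℕ) : Fin (n + 1) → F := Pi.single 0 1

lemma ext_v0 (i : ℕ) : ext (v0 F n) i = if i = 0 then 1 else 0 := by
  unfold ext v0
  by_cases h : i < n + 1
  · simp [h, Pi.single_apply, Fin.ext_iff]
  · have : i ≠ 0 := by omega
    simp [h, this]

lemma opF_pow_v0 (k : ℕ) (i : ℕ) (hi : i < n + 1) :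
    ext ((opF F n ^ k) (v0 F n)) i = if i = k then 1 else 0 := by
  induction k generalizing i with
  | zero => simp [ext_v0]
  | succ k ih =>
    rw [pow_succ', Module.End.mul_apply]
    cases i with
    | zero => simp [ext_opF_zero]
    | succ i => rw [ext_opF_succ _ _ hi, ih _ (by omega)]; simp

lemma sum_opF (x : Fin (n + 1) → F) :
    x = ∑ k ∈ Finset.range (n + 1), ext x k • (opF F n ^ k) (v0 F n) := by
  funext i
  rw [Finset.sum_apply]
  have : ∀ k ∈ Finset.range (n + 1), (ext x k • (opF F n ^ k) (v0 F n)) i =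
      if (i : ℕ) = k then ext x k else 0 := by
    intro k _
    rw [Pi.smul_apply, ← ext_fin ((opF F n ^ k) (v0 F n)) i, opF_pow_v0 _ _ i.2]
    simp
  rw [Finset.sum_congr rfl this, Finset.sum_ite_eq, if_pos (Finset.mem_range.mpr i.2), ext_fin]

lemma ker_opE {p : ℕ} [Fact p.Prime] [CharP F p] (hn : n < p) (x : Fin (n + 1) → F)
    (hx : opE F n x = 0) : x = ext x 0 • v0 F n := by
  refine ext_inj fun i hi => ?_
  rw [ext_smul, ext_v0]
  cases i with
  | zero => simp
  | succ i =>
    have h := ext_opE x i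
    rw [hx, ext_zero] at h
    have h1 : ((i : ℕ) + 1 : F) ≠ 0 := by
      have : ((i + 1 : ℕ) : F) ≠ 0 := by
        rw [Ne, CharP.cast_eq_zero_iff F p]
        intro hd
        have := Nat.le_of_dvd (by omega) hd
        omega
      simpa using this
    have h2 : (n : F) - (i : ℕ) ≠ 0 := by
      have : ((n - i : ℕ) : F) ≠ 0 := by
        rw [Ne, CharP.cast_eq_zero_iff F p]
        intro hd
        have := Nat.le_of_dvd (by omega) hd
        omega
      rwa [Nat.cast_sub (by omega)] at this
    have := mul_ne_zero h1 h2
    simp only [Nat.add_eq_zero_iff, one_ne_zero, and_false, if_false, mul_zero]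
    exact (mul_eq_zero.mp h.symm).resolve_left this

end

/-- A nilpotent operator on a nonzero invariant subset kills a nonzero vector. -/
lemma exists_ker {F V : Type} [Field F] [AddCommGroup V] [Module F V] (T : Module.End F V)
    (N : Submodule F V) (hN : ∀ x ∈ N, T x ∈ N) (k : ℕ) (x : V) (hx : x ∈ N) (hx0 : x ≠ 0)
    (hk : (T ^ k) x = 0) : ∃ y ∈ N, y ≠ 0 ∧ T y = 0 := by
  induction k generalizing x with
  | zero => exact absurd (by simpa using hk) hx0
  | succ k ih =>
    by_cases h : T x = 0
    · exact ⟨x, hx, hx0, h⟩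
    · exact ih (T x) (hN x hx) h (by rwa [pow_succ, Module.End.mul_apply] at hk)

lemma exists_eig {F V ι : Type} [Field F] [AddCommGroup V] [Module F V] (T : Module.End F V)
    (N : Submodule F V) (hN : ∀ x ∈ N, T x ∈ N) (s : Finset ι) (a : ι → F) (x : V) (hx : x ∈ N)
    (hx0 : x ≠ 0)
    (hk : Polynomial.aeval T (∏ i ∈ s, (Polynomial.X - Polynomial.C (a i))) x = 0) :
    ∃ i, ∃ y ∈ N, y ≠ 0 ∧ T y = a i • y := by
  classical
  induction s using Finset.induction_on generalizing x with
  | empty => exact absurd (by simpa using hk) hx0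
  | insert i s his ih =>
    by_cases h : T x - a i • x = 0
    · exact ⟨i, x, hx, hx0, sub_eq_zero.mp h⟩
    · refine ih (T x - a i • x) (N.sub_mem (hN x hx) (N.smul_mem _ hx)) h ?_
      rw [Finset.prod_insert his, mul_comm, map_mul, Module.End.mul_apply] at hk
      simpa [Algebra.algebraMap_eq_smul_one] using hk

lemma X_pow_sub_X {F : Type} [Field F] {p : ℕ} [Fact p.Prime] [CharP F p] :
    ∏ a : ZMod p, (Polynomial.X - Polynomial.C ((a.val : ℕ) : F)) =
      (Polynomial.X ^ p - Polynomial.X : Polynomial F) := by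
  have h : ∏ a : ZMod p, (Polynomial.X - Polynomial.C a) =
      (Polynomial.X ^ p - Polynomial.X : Polynomial (ZMod p)) := by
    have hr := FiniteField.roots_X_pow_card_sub_X (ZMod p)
    rw [ZMod.card] at hr
    have hd : (Polynomial.X ^ p - Polynomial.X : Polynomial (ZMod p)).natDegree = p :=
      FiniteField.X_pow_card_sub_X_natDegree_eq _ (Fact.out : p.Prime).one_lt
    have hm : (Polynomial.X ^ p - Polynomial.X : Polynomial (ZMod p)).Monic := by
      apply Polynomial.monic_X_pow_sub
      rw [Polynomial.degree_X]
      exact_mod_cast (Fact.out : p.Prime).one_lt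
    have := Polynomial.prod_multiset_X_sub_C_of_monic_of_roots_card_eq hm
      (by rw [hr, hd]; simp)
    rw [hr] at this
    exact this
  have h2 := congrArg (Polynomial.map (ZMod.castHom dvd_rfl F)) h
  rw [Polynomial.map_prod] at h2
  simpa using h2


section
variable {F : Type} [Field F] {L : Type} [LieRing L] [LieAlgebra F L]

lemma exists_hom {e h f : L} (b : Module.Basis (Fin 3) F L)
    (hb : ⇑b = ![e, h, f])
    (hhe : ⁅h, e⁆ = (2 : F) • e) (hhf : ⁅h, f⁆ = (-2 : F) • f) (hef : ⁅e, f⁆ = h) (n : ℕ) :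
    ∃ ρ : L →ₗ⁅F⁆ Module.End F (Fin (n + 1) → F),
      ρ e = opE F n ∧ ρ h = opH F n ∧ ρ f = opF F n := by
  have b0 : b 0 = e := by rw [hb]; rfl
  have b1 : b 1 = h := by rw [hb]; rfl
  have b2 : b 2 = f := by rw [hb]; rfl
  let r : L →ₗ[F] Module.End F (Fin (n + 1) → F) := b.constr F ![opE F n, opH F n, opF F n]
  have re : r e = opE F n := by rw [← b0]; simp [r]
  have rh : r h = opH F n := by rw [← b1]; simp [r]
  have rf : r f = opF F n := by rw [← b2]; simp [r]
  have heh : ⁅e, h⁆ = -((2 : F) • e) := by rw [← lie_skew, hhe]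
  have hfh : ⁅f, h⁆ = -((-2 : F) • f) := by rw [← lie_skew, hhf]
  have hfe : ⁅f, e⁆ = -h := by rw [← lie_skew, hef]
  have oeh : ⁅opE F n, opH F n⁆ = -((2 : F) • opE F n) := by rw [← lie_skew, rel_he]
  have ofh : ⁅opF F n, opH F n⁆ = -((-2 : F) • opF F n) := by rw [← lie_skew, rel_hf]
  have ofe : ⁅opF F n, opE F n⁆ = -opH F n := by rw [← lie_skew, rel_ef]
  have key : ∀ x y : L, r ⁅x, y⁆ = ⁅r x, r y⁆ := by
    let A : L →ₗ[F] L →ₗ[F] Module.End F (Fin (n + 1) → F) :=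
      LinearMap.mk₂ F (fun x y => r ⁅x, y⁆) (by simp) (by simp) (by simp) (by simp)
    let B : L →ₗ[F] L →ₗ[F] Module.End F (Fin (n + 1) → F) :=
      LinearMap.mk₂ F (fun x y => ⁅r x, r y⁆) (by simp)
        (fun c x y => by rw [map_smul]; simp [Ring.lie_def, smul_sub]) (by simp)
        (fun c x y => by rw [map_smul]; simp [Ring.lie_def, smul_sub])
    have hAB : A = B := by
      refine b.ext fun i => b.ext fun j => ?_
      change r ⁅b i, b j⁆ = ⁅r (b i), r (b j)⁆
      fin_cases i <;> fin_cases j <;>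
        simp only [Fin.zero_eta, Fin.mk_one, Fin.reduceFinMk, b0, b1, b2, lie_self, hhe, hhf, hef, heh, hfh,
          hfe, re, rh, rf, map_neg, map_smul, map_zero, rel_he, rel_hf, rel_ef, oeh, ofh, ofe]
    intro x y
    exact congrArg (fun T => T x y) hAB
  exact ⟨{ r with map_lie' := fun {x y} => key x y }, re, rh, rf⟩

lemma lie_mem_of_span {e h f : L} (hspan : Submodule.span F ({e, h, f} : Set L) = ⊤)
    {V : Type} [AddCommGroup V] [Module F V] [LieRingModule L V] [LieModule F L V]
    (N : Submodule F V) (he : ∀ x ∈ N, ⁅e, x⁆ ∈ N) (hh : ∀ x ∈ N, ⁅h, x⁆ ∈ N)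
    (hf : ∀ x ∈ N, ⁅f, x⁆ ∈ N) (y : L) (x : V) (hx : x ∈ N) : ⁅y, x⁆ ∈ N := by
  have hy : y ∈ Submodule.span F ({e, h, f} : Set L) := by rw [hspan]; trivial
  induction hy using Submodule.span_induction with
  | mem y hy =>
    rcases hy with rfl | rfl | rfl
    · exact he x hx
    · exact hh x hx
    · exact hf x hx
  | zero => simp
  | add a b _ _ ha hb => rw [add_lie]; exact N.add_mem ha hb
  | smul c a _ ha => rw [smul_lie]; exact N.smul_mem c ha

lemma hom_of_span {e h f : L} (hspan : Submodule.span F ({e, h, f} : Set L) = ⊤)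
    {V W : Type} [AddCommGroup V] [Module F V] [LieRingModule L V] [LieModule F L V]
    [AddCommGroup W] [Module F W] [LieRingModule L W] [LieModule F L W]
    (φ : V →ₗ[F] W) (he : ∀ x, φ ⁅e, x⁆ = ⁅e, φ x⁆) (hh : ∀ x, φ ⁅h, x⁆ = ⁅h, φ x⁆)
    (hf : ∀ x, φ ⁅f, x⁆ = ⁅f, φ x⁆) (y : L) (x : V) : φ ⁅y, x⁆ = ⁅y, φ x⁆ := by
  have hy : y ∈ Submodule.span F ({e, h, f} : Set L) := by rw [hspan]; trivial
  induction hy using Submodule.span_induction with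
  | mem y hy =>
    rcases hy with rfl | rfl | rfl
    · exact he x
    · exact hh x
    · exact hf x
  | zero => simp
  | add a b _ _ ha hb => rw [add_lie, map_add, ha, hb, add_lie]
  | smul c a _ ha => rw [smul_lie, map_smul, ha, smul_lie]

/-- The Lie ring module structure from a homomorphism. -/
abbrev lrm {n : ℕ} (ρ : L →ₗ⁅F⁆ Module.End F (Fin (n + 1) → F)) :
    LieRingModule L (Fin (n + 1) → F) where
  bracket x m := ρ x m
  add_lie x y m := by change ρ (x + y) m = ρ x m + ρ y m; simp
  lie_add x m m' := (ρ x).map_add m m'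
  leibniz_lie x y m := by
    change ρ x (ρ y m) = ρ ⁅x, y⁆ m + ρ y (ρ x m)
    rw [LieHom.map_lie, Ring.lie_def]; simp

lemma lm {n : ℕ} (ρ : L →ₗ⁅F⁆ Module.End F (Fin (n + 1) → F)) :
    letI := lrm ρ
    LieModule F L (Fin (n + 1) → F) :=
  letI := lrm ρ
  { smul_lie := fun t x m => by change ρ (t • x) m = t • ρ x m; simp
    lie_smul := fun t x m => (ρ x).map_smul t m }

lemma lm_toEnd {n : ℕ} (ρ : L →ₗ⁅F⁆ Module.End F (Fin (n + 1) → F)) (x : L) :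
    letI := lrm ρ
    letI := lm ρ
    LieModule.toEnd F L (Fin (n + 1) → F) x = ρ x := rfl

lemma lm_irr {n p : ℕ} [Fact p.Prime] [CharP F p] (hn : n < p) {e f : L}
    (ρ : L →ₗ⁅F⁆ Module.End F (Fin (n + 1) → F))
    (he : ρ e = opE F n) (hf : ρ f = opF F n) :
    letI := lrm ρ
    letI := lm ρ
    LieModule.IsIrreducible F L (Fin (n + 1) → F) := by
  letI := lrm ρ
  letI := lm ρ
  refine LieModule.IsIrreducible.mk fun N hN => ?_
  have Nee : ∀ x ∈ N, opE F n x ∈ N := fun x hx => by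
    rw [← he]; exact N.lie_mem (x := e) hx
  have Nf : ∀ x ∈ N, opF F n x ∈ N := fun x hx => by
    rw [← hf]; exact N.lie_mem (x := f) hx
  obtain ⟨x, hx, hx0⟩ : ∃ x ∈ N, x ≠ 0 := by
    rw [Ne, LieSubmodule.eq_bot_iff] at hN
    push Not at hN
    exact hN
  obtain ⟨y, hy, hy0, hey⟩ := exists_ker (opE F n) N.toSubmodule Nee p x hx hx0
    (by rw [opE_pow_p hn]; rfl)
  have hyv := ker_opE hn y hey
  have hc : ext y 0 ≠ 0 := fun hc => hy0 (by rw [hyv, hc, zero_smul])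
  have hv : v0 F n ∈ N := by
    have := N.smul_mem (ext y 0)⁻¹ hy
    rwa [hyv, smul_smul, ext_smul, ext_v0, if_pos rfl, mul_one, inv_mul_cancel₀ hc,
      one_smul] at this
  have hk : ∀ k, (opF F n ^ k) (v0 F n) ∈ N := fun k => by
    induction k with
    | zero => exact hv
    | succ k ih => rw [pow_succ', Module.End.mul_apply]; exact Nf _ ih
  rw [eq_top_iff]
  intro z _
  rw [sum_opF z]
  exact N.toSubmodule.sum_mem fun k _ => N.smul_mem _ (hk k)

/-- The model representation. -/
def mkRep {n p : ℕ} [Fact p.Prime] [CharP F p] (hn : n < p) {e h f : L}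
    (ρ : L →ₗ⁅F⁆ Module.End F (Fin (n + 1) → F))
    (he : ρ e = opE F n) (hh : ρ h = opH F n) (hf : ρ f = opF F n) :
    RestrictedIrredRep F p L e h f :=
  letI := lrm ρ
  letI := lm ρ
  { V := Fin (n + 1) → F
    irreducible := lm_irr hn ρ he hf
    res_e := by rw [lm_toEnd, he, opE_pow_p hn]
    res_h := by rw [lm_toEnd, hh, opH_pow_p]
    res_f := by rw [lm_toEnd, hf, opF_pow_p hn] }

open LieModule in
lemma prim_span {e h f : L} (hspan : Submodule.span F ({e, h, f} : Set L) = ⊤)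
    (t : IsSl2Triple h e f)
    {V : Type} [AddCommGroup V] [Module F V] [LieRingModule L V] [LieModule F L V]
    (irr : LieModule.IsIrreducible F L V) {w : V} {μ : F} (P : t.HasPrimitiveVectorWith w μ) :
    Submodule.span F (Set.range fun k : ℕ => (toEnd F L V f ^ k) w) = ⊤ := by
  set S := Submodule.span F (Set.range fun k : ℕ => (toEnd F L V f ^ k) w) with hS
  have mem : ∀ k, (toEnd F L V f ^ k) w ∈ S := fun k => Submodule.subset_span ⟨k, rfl⟩
  have aux : ∀ g : L, (∀ k, ⁅g, (toEnd F L V f ^ k) w⁆ ∈ S) → ∀ x ∈ S, ⁅g, x⁆ ∈ S := by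
    intro g hg x hx
    have : S ≤ S.comap (toEnd F L V g) := by
      rw [hS, Submodule.span_le]
      rintro _ ⟨k, rfl⟩
      exact hg k
    exact this hx
  let N : LieSubmodule F L V :=
    { S with
      lie_mem := fun {y x} hx => lie_mem_of_span hspan S
        (aux e fun k => by
          cases k with
          | zero => simp [P.lie_e]
          | succ k => rw [P.lie_e_pow_succ_toEnd_f]; exact S.smul_mem _ (mem k))
        (aux h fun k => by rw [P.lie_h_pow_toEnd_f]; exact S.smul_mem _ (mem k))
        (aux f fun k => by rw [P.lie_f_pow_toEnd_f]; exact mem _) y x hx }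
  have hN : N ≠ ⊥ := by
    rw [Ne, LieSubmodule.eq_bot_iff]
    exact fun h0 => P.ne_zero (h0 w (mem 0))
  have := (IsSimpleOrder.eq_bot_or_eq_top N).resolve_left hN
  exact congrArg LieSubmodule.toSubmodule this

open LieModule in
lemma prim_pow {p : ℕ} {e h f : L} (hspan : Submodule.span F ({e, h, f} : Set L) = ⊤)
    (t : IsSl2Triple h e f)
    {V : Type} [AddCommGroup V] [Module F V] [LieRingModule L V] [LieModule F L V]
    (irr : LieModule.IsIrreducible F L V) (hfp : toEnd F L V f ^ p = 0)
    {v : V} {n : ℕ} (P : t.HasPrimitiveVectorWith v (n : F)) :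
    (toEnd F L V f ^ (n + 1)) v = 0 := by
  by_contra h0
  have P' : t.HasPrimitiveVectorWith ((toEnd F L V f ^ (n + 1)) v)
      ((n : F) - 2 * ((n + 1 : ℕ) : F)) :=
    ⟨h0, P.lie_h_pow_toEnd_f _, by rw [P.lie_e_pow_succ_toEnd_f]; simp⟩
  have hs := prim_span hspan t irr P'
  have hle : (⊤ : Submodule F V) ≤ LinearMap.range (toEnd F L V f ^ (n + 1)) := by
    rw [← hs, Submodule.span_le]
    rintro _ ⟨k, rfl⟩
    refine ⟨(toEnd F L V f ^ k) v, ?_⟩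
    simp only [← Module.End.mul_apply, ← pow_add, add_comm]
  have hsur : Function.Surjective (toEnd F L V f ^ (n + 1)) :=
    LinearMap.range_eq_top.mp (top_le_iff.mp hle)
  have hsur2 : Function.Surjective ((toEnd F L V f ^ (n + 1)) ^ p) := by
    rw [Module.End.coe_pow]
    exact hsur.iterate p
  rw [← pow_mul, mul_comm, pow_mul, hfp, zero_pow (by omega)] at hsur2
  obtain ⟨x, hx⟩ := hsur2 v
  exact P.ne_zero hx.symm

open LieModule in
lemma exists_prim {p : ℕ} [Fact p.Prime] [CharP F p] {e h f : L} (t : IsSl2Triple h e f)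
    {V : Type} [AddCommGroup V] [Module F V] [LieRingModule L V] [LieModule F L V]
    [Nontrivial V] (hep : toEnd F L V e ^ p = 0) (hhp : toEnd F L V h ^ p = toEnd F L V h) :
    ∃ (n : ℕ) (v : V), n < p ∧ t.HasPrimitiveVectorWith v (n : F) := by
  obtain ⟨x, hx⟩ := exists_ne (0 : V)
  obtain ⟨y, -, hy0, hey⟩ := exists_ker (toEnd F L V e) ⊤ (fun _ _ => trivial) p x trivial hx
    (by rw [hep]; rfl)
  obtain ⟨a, v, hv, hv0, hhv⟩ := exists_eig (toEnd F L V h) (LinearMap.ker (toEnd F L V e))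
    (fun x hx => by
      rw [LinearMap.mem_ker, toEnd_apply_apply] at *
      rw [toEnd_apply_apply, leibniz_lie, hx, lie_zero, add_zero, ← lie_skew,
        t.lie_h_e_smul F, neg_lie, smul_lie, hx]; simp)
    Finset.univ (fun a : ZMod p => ((a.val : ℕ) : F)) y hey hy0
    (by rw [X_pow_sub_X]; simp [hhp])
  exact ⟨a.val, v, ZMod.val_lt a, hv0, hhv, hv⟩

open LieModule in
lemma iso_of_prim {p : ℕ} [Fact p.Prime] [CharP F p] {e h f : L}
    (hspan : Submodule.span F ({e, h, f} : Set L) = ⊤)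
    (t : IsSl2Triple h e f)
    {V : Type} [AddCommGroup V] [Module F V] [LieRingModule L V] [LieModule F L V]
    (irr : LieModule.IsIrreducible F L V) (hfp : toEnd F L V f ^ p = 0)
    {v : V} {n : ℕ} (hn : n < p) (P : t.HasPrimitiveVectorWith v (n : F))
    (ρ : L →ₗ⁅F⁆ Module.End F (Fin (n + 1) → F))
    (he : ρ e = opE F n) (hh : ρ h = opH F n) (hf : ρ f = opF F n) :
    letI := lrm ρ
    Nonempty (V ≃ₗ⁅F,L⁆ (Fin (n + 1) → F)) := by
  letI := lrm ρ
  letI := lm ρ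
  have irr' := lm_irr hn ρ he hf
  have hv := prim_pow hspan t irr hfp P
  let ψ : ℕ → V := fun k => (toEnd F L V f ^ k) v
  let φ : (Fin (n + 1) → F) →ₗ[F] V :=
    { toFun := fun x => ∑ k ∈ Finset.range (n + 1), ext x k • ψ k
      map_add' := fun x y => by simp [ext_add, add_smul, Finset.sum_add_distrib]
      map_smul' := fun c x => by simp [ext_smul, mul_smul, Finset.smul_sum] }
  have hφ : ∀ x, φ x = ∑ k ∈ Finset.range (n + 1), ext x k • ψ k := fun _ => rfl
  have hlie := hom_of_span (V := Fin (n + 1) → F) hspan φ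
    (fun x => by
      have : (⁅e, x⁆ : Fin (n + 1) → F) = opE F n x := by rw [← he]; rfl
      rw [this, hφ, hφ, lie_sum, Finset.sum_range_succ, Finset.sum_range_succ']
      simp only [lie_smul, ψ, P.lie_e_pow_succ_toEnd_f, ext_opE, smul_smul]
      simp [P.lie_e]
      exact Finset.sum_congr rfl fun k _ => by congr 1; ring)
    (fun x => by
      have : (⁅h, x⁆ : Fin (n + 1) → F) = opH F n x := by rw [← hh]; rfl
      rw [this, hφ, hφ, lie_sum]
      simp only [lie_smul, ψ, P.lie_h_pow_toEnd_f, ext_opH, smul_smul]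
      exact Finset.sum_congr rfl fun k _ => by congr 1; ring)
    (fun x => by
      have : (⁅f, x⁆ : Fin (n + 1) → F) = opF F n x := by rw [← hf]; rfl
      rw [this, hφ, hφ, lie_sum, Finset.sum_range_succ', Finset.sum_range_succ]
      simp only [lie_smul, ψ, P.lie_f_pow_toEnd_f, hv, ext_opF_zero]
      simp only [zero_smul, smul_zero, add_zero]
      exact Finset.sum_congr rfl fun k hk => by
        rw [ext_opF_succ _ _ (by simpa using hk)])
  let Φ : (Fin (n + 1) → F) →ₗ⁅F,L⁆ V := { φ with map_lie' := fun {y x} => hlie y x }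
  have hΦ : Φ (v0 F n) = v := by
    change φ (v0 F n) = v
    rw [hφ]
    simp [ext_v0, ψ]
  have hker : Φ.ker = ⊥ := by
    refine (IsSimpleOrder.eq_bot_or_eq_top Φ.ker).resolve_right fun htop => P.ne_zero ?_
    rw [← hΦ, ← LieModuleHom.mem_ker, htop]; trivial
  have hran : Φ.range = ⊤ := by
    refine (IsSimpleOrder.eq_bot_or_eq_top Φ.range).resolve_left fun hbot => P.ne_zero ?_
    have : v ∈ Φ.range := (LieModuleHom.mem_range _ _).mpr ⟨_, hΦ⟩
    rwa [hbot, LieSubmodule.mem_bot] at this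
  have hbij : Function.Bijective φ := by
    constructor
    · rw [injective_iff_map_eq_zero]
      intro x hx
      have : x ∈ Φ.ker := LieModuleHom.mem_ker.mpr hx
      rwa [hker, LieSubmodule.mem_bot] at this
    · intro y
      have : y ∈ Φ.range := by rw [hran]; trivial
      exact (LieModuleHom.mem_range _ _).mp this
  let E := LinearEquiv.ofBijective φ hbij
  let EE : (Fin (n + 1) → F) ≃ₗ⁅F,L⁆ V :=
    { Φ with
      invFun := E.symm
      left_inv := E.left_inv
      right_inv := E.right_inv }
  exact ⟨EE.symm⟩

end

end Sl2R

theorem sl2_restricted_irreducibles_card {F : Type} [Field F] [IsAlgClosed F] {p : ℕ}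
    [CharP F p] (hp : 3 ≤ p) {L : Type} [LieRing L] [LieAlgebra F L]
    (e h f : L)
    (hhe : ⁅h, e⁆ = (2 : F) • e) (hhf : ⁅h, f⁆ = (-2 : F) • f) (hef : ⁅e, f⁆ = h)
    (hspan : Submodule.span F ({e, h, f} : Set L) = ⊤)
    (hdim : Module.finrank F L = 3) :
    ∃ Vs : Fin p → RestrictedIrredRep F p L e h f,
      (∀ i j, i ≠ j → IsEmpty ((Vs i).V ≃ₗ⁅F,L⁆ (Vs j).V)) ∧
      (∀ W : RestrictedIrredRep F p L e h f, ∃ i, Nonempty (W.V ≃ₗ⁅F,L⁆ (Vs i).V)) := by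
  have hpp : p.Prime := (CharP.char_is_prime_or_zero F p).resolve_right (by omega)
  haveI : Fact p.Prime := ⟨hpp⟩
  have hrange : Set.range ![e, h, f] = {e, h, f} := by
    rw [Matrix.range_cons, Matrix.range_cons, Matrix.range_cons, Matrix.range_empty,
      Set.union_empty, Set.singleton_union, Set.singleton_union]
  let b : Module.Basis (Fin 3) F L :=
    basisOfTopLeSpanOfCardEqFinrank ![e, h, f] (by rw [hrange, hspan]) (by simp [hdim])
  have hb : ⇑b = ![e, h, f] := coe_basisOfTopLeSpanOfCardEqFinrank _ _ _
  have t : IsSl2Triple h e f :=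
    { h_ne_zero := by
        have h1 : b 1 = h := by rw [hb]; rfl
        rw [← h1]; exact b.ne_zero 1
      lie_e_f := hef
      lie_h_e_nsmul := by rw [hhe, two_smul, two_nsmul]
      lie_h_f_nsmul := by rw [hhf, neg_smul, two_smul, two_nsmul] }
  choose ρ he hh hf using Sl2R.exists_hom b hb hhe hhf hef
  refine ⟨fun i => Sl2R.mkRep i.2 (ρ i) (he i) (hh i) (hf i), ?_, ?_⟩
  · intro i j hij
    refine ⟨fun φ => hij ?_⟩
    let E : (Fin ((i : ℕ) + 1) → F) ≃ₗ[F] (Fin ((j : ℕ) + 1) → F) := φ.toLinearEquiv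
    have := E.finrank_eq
    simp only [Module.finrank_fin_fun] at this
    exact Fin.ext (by omega)
  · intro W
    haveI := W.irreducible
    haveI : Nontrivial W.V := (LieSubmodule.nontrivial_iff F L W.V).mp inferInstance
    obtain ⟨n, v, hn, P⟩ := Sl2R.exists_prim t W.res_e W.res_h
    exact ⟨⟨n, hn⟩, Sl2R.iso_of_prim hspan t W.irreducible W.res_f hn P (ρ n) (he n) (hh n) (hf n)⟩
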